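/- Let a = (a_1,a_2) ∈ ℝ² and b > 0, and let I = [a_1, a_1+2b] × [a_2, a_2+b]. Consider the two equivolume partitions of I into two sets: the square partition Ω_| = (Ω_{1,|}, Ω_{2,|}) with Ω_{1,|} = [a_1, a_1+b] × [a_2, a_2+b] and Ω_{2,|} = [a_1+b, a_1+2b] × [a_2, a_2+b], and the triangle partition Ω_\ = (Ω_{1,\}, Ω_{2,\}) with Ω_{1,\} = conv{a, a+(2b,0), a+(0,b)} and Ω_{2,\} = conv{a+(2b,0), a+(0,b), a+(2b,b)}. Then E L2²(P_{Ω_\}) < E L2²(P_{Ω_|}). -/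

import Mathlib

open MeasureTheory ProbabilityTheory

noncomputable section

namespace StratifiedSampling

variable {d : ℕ} {ι : Type} [Fintype ι]

/-- Lebesgue volume of a subset of `ℝ^d` as a real number. -/
def vol (s : Set (Fin d → ℝ)) : ℝ := (volume s).toReal

/-- Number of points of the configuration `p` that lie in the lower box `(-∞, x]`. -/
def countIn (p : ι → (Fin d → ℝ)) (x : Fin d → ℝ) : ℝ :=
  ∑ i, Set.indicator (Set.Iic x) (fun _ => (1 : ℝ)) (p i)

/-- Discrepancy function of the point configuration `p` in the set `K`:
`d_P(x) = #(P ∩ (-∞,x])/N − |K ∩ (-∞,x]|/|K|`. -/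
def discrep (K : Set (Fin d → ℝ)) (p : ι → (Fin d → ℝ)) (x : Fin d → ℝ) : ℝ :=
  countIn p x / (Fintype.card ι : ℝ) - vol (K ∩ Set.Iic x) / vol K

/-- Joint distribution of the stratified sample associated with the family `Ω`:
the points are independent and the `i`-th point is uniformly distributed on `Ω i`. -/
def stratDist (Ω : ι → Set (Fin d → ℝ)) : Measure (ι → (Fin d → ℝ)) :=
  Measure.pi fun i => ProbabilityTheory.cond volume (Ω i)

/-- Mean squared `L2`-discrepancy of the stratified sample from the family `Ω` in `K`:
`E L2²(P_Ω) = E[(1/|K|) ∫_K d_{P_Ω}(x)² dx]`. -/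
def meanL2sq (K : Set (Fin d → ℝ)) (Ω : ι → Set (Fin d → ℝ)) : ℝ :=
  ∫ p, ((1 / vol K) * ∫ x in K, (discrep K p x) ^ 2) ∂(stratDist Ω)

/-- `Ω` is a partition of `K`: measurable sets of positive volume whose union
is `K` and whose distinct members have disjoint interiors. -/
structure IsPartition (K : Set (Fin d → ℝ)) (Ω : ι → Set (Fin d → ℝ)) : Prop where
  measurableSet : ∀ i, MeasurableSet (Ω i)
  vol_pos : ∀ i, 0 < volume (Ω i)
  iUnion_eq : (⋃ i, Ω i) = K
  disjoint_interiors : ∀ i j, i ≠ j → interior (Ω i) ∩ interior (Ω j) = ∅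

/-- All members of `Ω` have the same volume. -/
def IsEquivolume (Ω : ι → Set (Fin d → ℝ)) : Prop :=
  ∀ i j, volume (Ω i) = volume (Ω j)

/-- `q_i(x) = |Ω_i ∩ (-∞,x]| / |Ω_i|`. -/
def qfun (Ω : ι → Set (Fin d → ℝ)) (i : ι) (x : Fin d → ℝ) : ℝ :=
  vol (Ω i ∩ Set.Iic x) / vol (Ω i)

end StratifiedSampling

namespace StratifiedSampling

lemma measurable_vol_inter_Iic {d : ℕ} {S : Set (Fin d → ℝ)} (hS : MeasurableSet S) :
    Measurable fun x : Fin d → ℝ => vol (S ∩ Set.Iic x) := by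
  have hm : MeasurableSet {z : (Fin d → ℝ) × (Fin d → ℝ) | z.2 ∈ S ∧ z.2 ≤ z.1} :=
    (measurable_snd hS).inter (isClosed_le continuous_snd continuous_fst).measurableSet
  exact (measurable_measure_prodMk_left (ν := volume) hm).ennreal_toReal

lemma vol_inter_div_mem_Icc {d : ℕ} {S : Set (Fin d → ℝ)} (hS : volume S ≠ ⊤)
    (T : Set (Fin d → ℝ)) : vol (S ∩ T) / vol S ∈ Set.Icc (0 : ℝ) 1 :=
  ⟨div_nonneg ENNReal.toReal_nonneg ENNReal.toReal_nonneg,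
    div_le_one_of_le₀ (ENNReal.toReal_mono hS (measure_mono Set.inter_subset_left))
      ENNReal.toReal_nonneg⟩

lemma countIn_div_card_mem_Icc {d : ℕ} {ι : Type} [Fintype ι] (p : ι → Fin d → ℝ)
    (x : Fin d → ℝ) : countIn p x / (Fintype.card ι : ℝ) ∈ Set.Icc (0 : ℝ) 1 := by
  have h0 : 0 ≤ countIn p x :=
    Finset.sum_nonneg fun i _ => Set.indicator_nonneg (fun _ _ => zero_le_one) _
  have h1 : countIn p x ≤ Fintype.card ι := by
    calc countIn p x ≤ ∑ _i : ι, (1 : ℝ) :=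
          Finset.sum_le_sum fun i _ => Set.indicator_le_self' (fun _ _ => zero_le_one) _
      _ = Fintype.card ι := by simp
  exact ⟨div_nonneg h0 (Nat.cast_nonneg _), div_le_one_of_le₀ h1 (Nat.cast_nonneg _)⟩

lemma measurable_discrep {d : ℕ} {ι : Type} [Fintype ι] {K : Set (Fin d → ℝ)}
    (hK : MeasurableSet K) :
    Measurable fun z : (ι → Fin d → ℝ) × (Fin d → ℝ) => discrep K z.1 z.2 := by
  have hc : Measurable fun z : (ι → Fin d → ℝ) × (Fin d → ℝ) => countIn z.1 z.2 := by
    refine Finset.measurable_sum _ fun i _ => ?_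
    have hs : MeasurableSet {z : (ι → Fin d → ℝ) × (Fin d → ℝ) | z.1 i ≤ z.2} :=
      (isClosed_le (by fun_prop) (by fun_prop)).measurableSet
    exact (measurable_const (a := (1 : ℝ))).indicator hs
  exact (hc.div_const _).sub (((measurable_vol_inter_Iic hK).comp measurable_snd).div_const _)

lemma discrep_sq_le_one {d : ℕ} {ι : Type} [Fintype ι] {K : Set (Fin d → ℝ)}
    (hK : volume K ≠ ⊤) (p : ι → Fin d → ℝ) (x : Fin d → ℝ) : discrep K p x ^ 2 ≤ 1 := by
  obtain ⟨h1, h2⟩ := countIn_div_card_mem_Icc p x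
  obtain ⟨h3, h4⟩ := vol_inter_div_mem_Icc hK (Set.Iic x)
  unfold discrep
  rw [sq_le_one_iff_abs_le_one, abs_le]
  constructor <;> linarith

lemma integral_discrep_sq_fin_two {d : ℕ} (K : Set (Fin d → ℝ)) {Ω : Fin 2 → Set (Fin d → ℝ)}
    (hm : ∀ i, MeasurableSet (Ω i)) (h0 : ∀ i, volume (Ω i) ≠ 0) (ht : ∀ i, volume (Ω i) ≠ ⊤)
    (x : Fin d → ℝ)
    (hq : qfun Ω 0 x + qfun Ω 1 x = 2 * (vol (K ∩ Set.Iic x) / vol K)) :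
    ∫ p, discrep K p x ^ 2 ∂(stratDist Ω) =
      (vol (K ∩ Set.Iic x) / vol K) / 2 - (vol (K ∩ Set.Iic x) / vol K) ^ 2
        + qfun Ω 0 x * qfun Ω 1 x / 2 := by
  have hprob : ∀ i, IsProbabilityMeasure (ProbabilityTheory.cond volume (Ω i)) :=
    fun i => cond_isProbabilityMeasure_of_finite (h0 i) (ht i)
  set s := vol (K ∩ Set.Iic x) / vol K with hs
  set f : (Fin d → ℝ) → ℝ := Set.indicator (Set.Iic x) (fun _ => (1 : ℝ)) with hf
  have hfm : Measurable f := measurable_const.indicator measurableSet_Iic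
  have hfi : ∀ i, ∫ y, f y ∂(ProbabilityTheory.cond volume (Ω i)) = qfun Ω i x := by
    intro i
    rw [hf, integral_indicator_const _ measurableSet_Iic, measureReal_def, cond_apply (hm i)]
    simp [qfun, vol, div_eq_inv_mul]
  have hsq : ∀ y, f y ^ 2 = f y := by
    intro y
    by_cases hy : y ∈ Set.Iic x <;> simp [hf, hy]
  have hb : ∀ y, ‖f y‖ ≤ 1 := by
    intro y
    by_cases hy : y ∈ Set.Iic x <;> simp [hf, hy]
  have hI : ∀ i : Fin 2, Integrable (fun p : Fin 2 → Fin d → ℝ => f (p i)) (stratDist Ω) :=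
    fun i => by
      unfold stratDist
      exact Integrable.of_bound (hfm.comp (measurable_pi_apply i)).aestronglyMeasurable 1
        (Filter.Eventually.of_forall fun p => hb _)
  have hI2 : Integrable (fun p : Fin 2 → Fin d → ℝ => f (p 0) * f (p 1)) (stratDist Ω) := by
    unfold stratDist
    refine Integrable.of_bound ((hfm.comp (measurable_pi_apply 0)).mul
      (hfm.comp (measurable_pi_apply 1))).aestronglyMeasurable 1
        (Filter.Eventually.of_forall fun p => ?_)
    rw [norm_mul]
    exact mul_le_one₀ (hb _) (norm_nonneg _) (hb _)
  have e1 : ∀ i, ∫ p, f (p i) ∂(stratDist Ω) = qfun Ω i x := by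
    intro i
    rw [← hfi i]
    exact integral_comp_eval hfm.aestronglyMeasurable
  have e2 : ∫ p, f (p 0) * f (p 1) ∂(stratDist Ω) = qfun Ω 0 x * qfun Ω 1 x := by
    have := integral_fintype_prod_eq_prod (μ := fun i => ProbabilityTheory.cond volume (Ω i))
      (fun _ : Fin 2 => f)
    simpa [Fin.prod_univ_two, hfi, stratDist] using this
  have hexp : ∀ p : Fin 2 → Fin d → ℝ, discrep K p x ^ 2 =
      (1 / 4 - s) * f (p 0) + (1 / 4 - s) * f (p 1) + 1 / 2 * (f (p 0) * f (p 1)) + s ^ 2 := by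
    intro p
    have : discrep K p x = (f (p 0) + f (p 1)) / 2 - s := by
      simp [discrep, countIn, hs, hf]
    rw [this]
    linear_combination (1 / 4) * hsq (p 0) + (1 / 4) * hsq (p 1)
  have : IsProbabilityMeasure (stratDist Ω) := by unfold stratDist; infer_instance
  simp_rw [hexp]
  have A := (hI 0).const_mul (1 / 4 - s)
  have B := (hI 1).const_mul (1 / 4 - s)
  have C := hI2.const_mul (1 / 2)
  rw [integral_add (by exact (A.add B).add C) (integrable_const _),
    integral_add (by exact A.add B) C, integral_add A B, integral_const_mul,
    integral_const_mul, integral_const_mul, e1, e1, e2]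
  simp only [integral_const, probReal_univ, smul_eq_mul, one_mul]
  linear_combination (1 / 4 - s) * hq

lemma integrableOn_qfun_mul_qfun {d : ℕ} {ι : Type} {K : Set (Fin d → ℝ)}
    (hK : volume K ≠ ⊤) {Ω : ι → Set (Fin d → ℝ)}
    (hm : ∀ i, MeasurableSet (Ω i)) (ht : ∀ i, volume (Ω i) ≠ ⊤) (i j : ι) :
    IntegrableOn (fun x => qfun Ω i x * qfun Ω j x) K := by
  have : IsFiniteMeasure (volume.restrict K) := isFiniteMeasure_restrict.2 hK
  refine Integrable.of_bound ((((measurable_vol_inter_Iic (hm i)).div_const _).mul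
    ((measurable_vol_inter_Iic (hm j)).div_const _)).aestronglyMeasurable) 1
    (Filter.Eventually.of_forall fun x => ?_)
  have h1 := vol_inter_div_mem_Icc (ht i) (Set.Iic x)
  have h2 := vol_inter_div_mem_Icc (ht j) (Set.Iic x)
  change ‖_ / _ * (_ / _)‖ ≤ 1
  rw [norm_mul, Real.norm_of_nonneg h1.1, Real.norm_of_nonneg h2.1]
  exact mul_le_one₀ h1.2 h2.1 h2.2

lemma meanL2sq_fin_two {d : ℕ} {K : Set (Fin d → ℝ)} (hKm : MeasurableSet K)
    (hK : volume K ≠ ⊤) {Ω : Fin 2 → Set (Fin d → ℝ)}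
    (hm : ∀ i, MeasurableSet (Ω i)) (h0 : ∀ i, volume (Ω i) ≠ 0) (ht : ∀ i, volume (Ω i) ≠ ⊤)
    (hq : ∀ x ∈ K, qfun Ω 0 x + qfun Ω 1 x = 2 * (vol (K ∩ Set.Iic x) / vol K)) :
    meanL2sq K Ω = 1 / vol K *
      ((∫ x in K, ((vol (K ∩ Set.Iic x) / vol K) / 2 - (vol (K ∩ Set.Iic x) / vol K) ^ 2))
        + (∫ x in K, qfun Ω 0 x * qfun Ω 1 x) / 2) := by
  have hprob : ∀ i, IsProbabilityMeasure (ProbabilityTheory.cond volume (Ω i)) :=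
    fun i => cond_isProbabilityMeasure_of_finite (h0 i) (ht i)
  have : IsProbabilityMeasure (stratDist Ω) := by unfold stratDist; infer_instance
  have : IsFiniteMeasure (volume.restrict K) := isFiniteMeasure_restrict.2 hK
  have hs : IntegrableOn (fun x => (vol (K ∩ Set.Iic x) / vol K) / 2
      - (vol (K ∩ Set.Iic x) / vol K) ^ 2) K := by
    have hmeas : Measurable fun x => vol (K ∩ Set.Iic x) / vol K :=
      (measurable_vol_inter_Iic hKm).div_const _
    refine Integrable.of_bound
      ((hmeas.div_const _).sub (hmeas.pow_const _)).aestronglyMeasurable 1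
      (Filter.Eventually.of_forall fun x => ?_)
    have h1 := vol_inter_div_mem_Icc hK (Set.Iic x)
    rw [Real.norm_eq_abs, abs_le]
    constructor <;> nlinarith [h1.1, h1.2]
  have hprod : Integrable (Function.uncurry fun (p : Fin 2 → Fin d → ℝ) (x : Fin d → ℝ) =>
      discrep K p x ^ 2) ((stratDist Ω).prod (volume.restrict K)) := by
    refine Integrable.of_bound
      ((measurable_discrep hKm).pow_const 2).aestronglyMeasurable 1
      (Filter.Eventually.of_forall fun z => ?_)
    rw [Function.uncurry, Real.norm_of_nonneg (sq_nonneg _)]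
    exact discrep_sq_le_one hK _ _
  unfold meanL2sq
  rw [integral_const_mul, integral_integral_swap hprod, ← integral_div, ← integral_add hs
    ((integrableOn_qfun_mul_qfun hK hm ht 0 1).div_const 2)]
  congr 1
  exact setIntegral_congr_fun hKm fun x hx => integral_discrep_sq_fin_two K hm h0 ht x (hq x hx)

lemma convexHull_lower_triangle (a₁ a₂ b : ℝ) (hb : 0 < b) :
    convexHull ℝ {![a₁, a₂], ![a₁ + 2 * b, a₂], ![a₁, a₂ + b]} =
      {y : Fin 2 → ℝ | a₁ ≤ y 0 ∧ a₂ ≤ y 1 ∧ y 0 + 2 * y 1 ≤ a₁ + 2 * a₂ + 2 * b} := by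
  apply Set.Subset.antisymm
  · refine convexHull_min ?_ ?_
    · rintro y (rfl | rfl | rfl) <;> simp <;> (try constructor) <;> linarith
    · rintro x ⟨h1, h2, h3⟩ y ⟨g1, g2, g3⟩ s t hs ht hst
      obtain rfl : t = 1 - s := by linarith
      simp only [Set.mem_ofPred_eq, Pi.add_apply, Pi.smul_apply, smul_eq_mul]
      refine ⟨?_, ?_, ?_⟩ <;> nlinarith
  · rintro y ⟨h1, h2, h3⟩
    have hc := convex_convexHull ℝ ({![a₁, a₂], ![a₁ + 2 * b, a₂], ![a₁, a₂ + b]} :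
      Set (Fin 2 → ℝ))
    have hmem := hc.sum_mem (t := Finset.univ)
      (w := ![1 - (y 0 - a₁) / (2 * b) - (y 1 - a₂) / b, (y 0 - a₁) / (2 * b), (y 1 - a₂) / b])
      (z := ![![a₁, a₂], ![a₁ + 2 * b, a₂], ![a₁, a₂ + b]])
      (by
        intro i _
        fin_cases i
        · have : 1 - (y 0 - a₁) / (2 * b) - (y 1 - a₂) / b
              = (a₁ + 2 * a₂ + 2 * b - (y 0 + 2 * y 1)) / (2 * b) := by field_simp; ring
          simp only [Fin.zero_eta, Matrix.cons_val_zero, this]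
          exact div_nonneg (by linarith) (by linarith)
        · exact div_nonneg (by linarith) (by linarith)
        · exact div_nonneg (by linarith) (by linarith))
      (by simp [Fin.sum_univ_three]; ring)
      (by
        intro i _
        apply subset_convexHull
        fin_cases i <;> simp)
    convert hmem using 1
    ext i
    fin_cases i <;> simp [Fin.sum_univ_three] <;> field_simp <;> ring

lemma convexHull_upper_triangle (a₁ a₂ b : ℝ) (hb : 0 < b) :
    convexHull ℝ {![a₁ + 2 * b, a₂], ![a₁, a₂ + b], ![a₁ + 2 * b, a₂ + b]} =
      {y : Fin 2 → ℝ | y 0 ≤ a₁ + 2 * b ∧ y 1 ≤ a₂ + b ∧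
        a₁ + 2 * a₂ + 2 * b ≤ y 0 + 2 * y 1} := by
  apply Set.Subset.antisymm
  · refine convexHull_min ?_ ?_
    · rintro y (rfl | rfl | rfl) <;> simp <;> (try constructor) <;> linarith
    · rintro x ⟨h1, h2, h3⟩ y ⟨g1, g2, g3⟩ s t hs ht hst
      obtain rfl : t = 1 - s := by linarith
      simp only [Set.mem_ofPred_eq, Pi.add_apply, Pi.smul_apply, smul_eq_mul]
      refine ⟨?_, ?_, ?_⟩ <;> nlinarith
  · rintro y ⟨h1, h2, h3⟩
    have hc := convex_convexHull ℝ ({![a₁ + 2 * b, a₂], ![a₁, a₂ + b], ![a₁ + 2 * b, a₂ + b]} :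
      Set (Fin 2 → ℝ))
    have hmem := hc.sum_mem (t := Finset.univ)
      (w := ![(a₂ + b - y 1) / b, (a₁ + 2 * b - y 0) / (2 * b),
        1 - (a₂ + b - y 1) / b - (a₁ + 2 * b - y 0) / (2 * b)])
      (z := ![![a₁ + 2 * b, a₂], ![a₁, a₂ + b], ![a₁ + 2 * b, a₂ + b]])
      (by
        intro i _
        fin_cases i
        · exact div_nonneg (by linarith) (by linarith)
        · exact div_nonneg (by linarith) (by linarith)
        · have : 1 - (a₂ + b - y 1) / b - (a₁ + 2 * b - y 0) / (2 * b)
              = (y 0 + 2 * y 1 - (a₁ + 2 * a₂ + 2 * b)) / (2 * b) := by field_simp; ring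
          simp only [Fin.reduceFinMk, Matrix.cons_val, this]
          exact div_nonneg (by linarith) (by linarith))
      (by simp [Fin.sum_univ_three])
      (by
        intro i _
        apply subset_convexHull
        fin_cases i <;> simp)
    convert hmem using 1
    ext i
    fin_cases i <;> simp [Fin.sum_univ_three] <;> field_simp <;> ring

lemma volume_eq_lintegral_slice {S : Set (Fin 2 → ℝ)} (hS : MeasurableSet S) :
    volume S = ∫⁻ t, volume {u : ℝ | ![t, u] ∈ S} := by
  have h := (volume_preserving_finTwoArrow ℝ).symm
  rw [← h.measure_preimage hS.nullMeasurableSet, Measure.volume_eq_prod,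
    Measure.prod_apply ((MeasurableEquiv.measurable _) hS)]
  rfl

lemma lintegral_corner (X Y c : ℝ) :
    ∫⁻ t, (if t ≤ X then ENNReal.ofReal (Y - (c - t) / 2) else 0) =
      ENNReal.ofReal ((max (X + 2 * Y - c) 0) ^ 2 / 4) := by
  have h1 : (fun t : ℝ => if t ≤ X then ENNReal.ofReal (Y - (c - t) / 2) else 0) =
      (Set.Ioc (c - 2 * Y) X).indicator fun t => ENNReal.ofReal (Y - (c - t) / 2) := by
    ext t
    by_cases ht : t ≤ X <;> by_cases hc : c - 2 * Y < t
    · simp [ht, hc]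
    · have : Y - (c - t) / 2 ≤ 0 := by linarith
      simp [ht, hc, this]
    · simp [ht]
    · simp [ht]
  rw [h1, lintegral_indicator measurableSet_Ioc]
  rcases le_total X (c - 2 * Y) with h | h
  · rw [Set.Ioc_eq_empty (by linarith), max_eq_right (by linarith)]
    simp
  · rw [← ofReal_integral_eq_lintegral_ofReal, ← intervalIntegral.integral_of_le h,
      max_eq_left (by linarith)]
    · congr 1
      rw [intervalIntegral.integral_eq_sub_of_hasDerivAt
        (f := fun t => (t - (c - 2 * Y)) ^ 2 / 4)]
      · ring
      · intro t _
        have := (((hasDerivAt_id t).sub_const (c - 2 * Y)).pow 2).div_const 4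
        refine this.congr_deriv ?_
        norm_num
        ring
      · exact Continuous.intervalIntegrable (by fun_prop) _ _
    · exact (Continuous.integrableOn_Icc (by fun_prop)).mono_set Set.Ioc_subset_Icc_self
    · refine (ae_restrict_iff' measurableSet_Ioc).2 (Filter.Eventually.of_forall fun t ht => ?_)
      have := ht.1
      change 0 ≤ _
      linarith

lemma volume_corner_le (X Y c : ℝ) :
    volume {y : Fin 2 → ℝ | y 0 ≤ X ∧ y 1 ≤ Y ∧ c ≤ y 0 + 2 * y 1} =
      ENNReal.ofReal ((max (X + 2 * Y - c) 0) ^ 2 / 4) := by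
  rw [volume_eq_lintegral_slice (by measurability), ← lintegral_corner]
  refine lintegral_congr fun t => ?_
  split_ifs with ht
  · rw [← Real.volume_Icc]
    congr 1
    ext u
    simp only [Set.mem_ofPred_eq, Set.mem_Icc, Matrix.cons_val_zero, Matrix.cons_val_one]
    constructor
    · rintro ⟨_, h1, h2⟩; constructor <;> linarith
    · rintro ⟨h1, h2⟩; refine ⟨ht, ?_, ?_⟩ <;> linarith
  · simp [ht]

lemma volume_corner_lt (X Y c : ℝ) :
    volume {y : Fin 2 → ℝ | y 0 ≤ X ∧ y 1 ≤ Y ∧ c < y 0 + 2 * y 1} =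
      ENNReal.ofReal ((max (X + 2 * Y - c) 0) ^ 2 / 4) := by
  rw [volume_eq_lintegral_slice (by measurability), ← lintegral_corner]
  refine lintegral_congr fun t => ?_
  split_ifs with ht
  · rw [← Real.volume_Ioc]
    congr 1
    ext u
    simp only [Set.mem_ofPred_eq, Set.mem_Ioc, Matrix.cons_val_zero, Matrix.cons_val_one]
    constructor
    · rintro ⟨_, h1, h2⟩; constructor <;> linarith
    · rintro ⟨h1, h2⟩; refine ⟨ht, ?_, ?_⟩ <;> linarith
  · simp [ht]

lemma mem_Icc_vec {p q r s : ℝ} {y : Fin 2 → ℝ} :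
    y ∈ Set.Icc ![p, q] ![r, s] ↔ (p ≤ y 0 ∧ q ≤ y 1) ∧ y 0 ≤ r ∧ y 1 ≤ s := by
  simp [Pi.le_def, Fin.forall_fin_two]

lemma mem_Iic_fin_two {x y : Fin 2 → ℝ} : y ∈ Set.Iic x ↔ y 0 ≤ x 0 ∧ y 1 ≤ x 1 := by
  simp [Pi.le_def, Fin.forall_fin_two]

lemma vol_Icc_vec (p q r s : ℝ) :
    vol (Set.Icc ![p, q] ![r, s]) = max (r - p) 0 * max (s - q) 0 := by
  simp [vol, Real.volume_Icc_pi, Fin.prod_univ_two, ENNReal.toReal_ofReal']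

lemma vol_Icc_vec_inter_Iic (p q r s : ℝ) (x : Fin 2 → ℝ) :
    vol (Set.Icc ![p, q] ![r, s] ∩ Set.Iic x) =
      max (min r (x 0) - p) 0 * max (min s (x 1) - q) 0 := by
  rw [← vol_Icc_vec]
  congr 1
  ext y
  rw [Set.mem_inter_iff, mem_Icc_vec, mem_Icc_vec, mem_Iic_fin_two, le_min_iff, le_min_iff]
  tauto

lemma vol_upper_triangle_inter_Iic {a₁ a₂ b : ℝ} (hb : 0 < b) {x : Fin 2 → ℝ}
    (hx : x ∈ Set.Icc ![a₁, a₂] ![a₁ + 2 * b, a₂ + b]) :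
    vol (convexHull ℝ {![a₁ + 2 * b, a₂], ![a₁, a₂ + b], ![a₁ + 2 * b, a₂ + b]} ∩ Set.Iic x) =
      max (x 0 + 2 * x 1 - (a₁ + 2 * a₂ + 2 * b)) 0 ^ 2 / 4 := by
  obtain ⟨⟨-, -⟩, h3, h4⟩ := mem_Icc_vec.1 hx
  rw [convexHull_upper_triangle a₁ a₂ b hb,
    ← ENNReal.toReal_ofReal (r := max (x 0 + 2 * x 1 - _) 0 ^ 2 / 4) (by positivity),
    ← volume_corner_le, vol]
  congr 2
  ext y
  rw [Set.mem_inter_iff, mem_Iic_fin_two]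
  constructor
  · rintro ⟨⟨-, -, h⟩, h5, h6⟩
    exact ⟨h5, h6, h⟩
  · rintro ⟨h5, h6, h⟩
    exact ⟨⟨h5.trans h3, h6.trans h4, h⟩, h5, h6⟩

lemma vol_lower_triangle_inter_Iic {a₁ a₂ b : ℝ} (hb : 0 < b) {x : Fin 2 → ℝ}
    (hx : x ∈ Set.Icc ![a₁, a₂] ![a₁ + 2 * b, a₂ + b]) :
    vol (convexHull ℝ {![a₁, a₂], ![a₁ + 2 * b, a₂], ![a₁, a₂ + b]} ∩ Set.Iic x) =
      (x 0 - a₁) * (x 1 - a₂) - max (x 0 + 2 * x 1 - (a₁ + 2 * a₂ + 2 * b)) 0 ^ 2 / 4 := by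
  obtain ⟨⟨h1, h2⟩, h3, h4⟩ := mem_Icc_vec.1 hx
  set c := a₁ + 2 * a₂ + 2 * b with hc
  have hset : convexHull ℝ {![a₁, a₂], ![a₁ + 2 * b, a₂], ![a₁, a₂ + b]} ∩ Set.Iic x =
      Set.Icc ![a₁, a₂] ![x 0, x 1] \
        {y : Fin 2 → ℝ | y 0 ≤ x 0 ∧ y 1 ≤ x 1 ∧ c < y 0 + 2 * y 1} := by
    ext y
    rw [convexHull_lower_triangle a₁ a₂ b hb, Set.mem_inter_iff, Set.mem_sdiff, mem_Iic_fin_two,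
      mem_Icc_vec]
    simp only [Set.mem_ofPred_eq, not_and, not_lt, ← hc]
    tauto
  have hsub : {y : Fin 2 → ℝ | y 0 ≤ x 0 ∧ y 1 ≤ x 1 ∧ c < y 0 + 2 * y 1} ⊆
      Set.Icc ![a₁, a₂] ![x 0, x 1] := by
    rintro y ⟨h5, h6, h7⟩
    refine mem_Icc_vec.2 ⟨⟨?_, ?_⟩, h5, h6⟩ <;> linarith
  have hm : MeasurableSet {y : Fin 2 → ℝ | y 0 ≤ x 0 ∧ y 1 ≤ x 1 ∧ c < y 0 + 2 * y 1} := by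
    measurability
  have hbox := vol_Icc_vec a₁ a₂ (x 0) (x 1)
  rw [max_eq_left (by linarith), max_eq_left (by linarith)] at hbox
  rw [hset, vol, ← measureReal_def, measureReal_sdiff hsub hm (by simp [Real.volume_Icc_pi,
    ENNReal.mul_eq_top, Fin.prod_univ_two]), measureReal_def, measureReal_def,
    volume_corner_lt, ENNReal.toReal_ofReal (by positivity), ← hbox, vol]

lemma vol_upper_triangle {a₁ a₂ b : ℝ} (hb : 0 < b) :
    vol (convexHull ℝ {![a₁ + 2 * b, a₂], ![a₁, a₂ + b], ![a₁ + 2 * b, a₂ + b]}) = b ^ 2 := by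
  have h := vol_upper_triangle_inter_Iic (a₁ := a₁) (a₂ := a₂) hb
    (x := ![a₁ + 2 * b, a₂ + b]) (by rw [mem_Icc_vec]; simp [hb.le])
  rw [Set.inter_eq_left.2] at h
  · rw [h]
    simp only [Matrix.cons_val_zero, Matrix.cons_val_one]
    rw [max_eq_left (by linarith)]
    ring
  · rw [convexHull_upper_triangle a₁ a₂ b hb]
    rintro y ⟨h1, h2, -⟩
    exact mem_Iic_fin_two.2 ⟨h1, h2⟩

lemma vol_lower_triangle {a₁ a₂ b : ℝ} (hb : 0 < b) :
    vol (convexHull ℝ {![a₁, a₂], ![a₁ + 2 * b, a₂], ![a₁, a₂ + b]}) = b ^ 2 := by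
  have h := vol_lower_triangle_inter_Iic (a₁ := a₁) (a₂ := a₂) hb
    (x := ![a₁ + 2 * b, a₂ + b]) (by rw [mem_Icc_vec]; simp [hb.le])
  rw [Set.inter_eq_left.2] at h
  · rw [h]
    simp only [Matrix.cons_val_zero, Matrix.cons_val_one]
    rw [max_eq_left (by linarith)]
    ring
  · rw [convexHull_lower_triangle a₁ a₂ b hb]
    rintro y ⟨h1, h2, h3⟩
    refine mem_Iic_fin_two.2 ⟨?_, ?_⟩ <;> simp <;> linarith

lemma setIntegral_Icc_vec {f : ℝ → ℝ → ℝ} (hf : Continuous (Function.uncurry f))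
    {p q r s : ℝ} (hpr : p ≤ r) (hqs : q ≤ s) :
    ∫ x in Set.Icc ![p, q] ![r, s], f (x 0) (x 1) = ∫ t in p..r, ∫ u in q..s, f t u := by
  have hset : Set.Icc ![p, q] ![r, s] = (MeasurableEquiv.finTwoArrow : (Fin 2 → ℝ) ≃ᵐ ℝ × ℝ) ⁻¹'
      (Set.Icc p r ×ˢ Set.Icc q s) := by
    ext y
    rw [mem_Icc_vec]
    simp [MeasurableEquiv.finTwoArrow]
  have h := (volume_preserving_finTwoArrow ℝ).setIntegral_preimage_emb
    (MeasurableEquiv.measurableEmbedding _) (Function.uncurry f) (Set.Icc p r ×ˢ Set.Icc q s)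
  rw [hset]
  refine Eq.trans h ?_
  rw [Measure.volume_eq_prod, setIntegral_prod _
    (hf.continuousOn.integrableOn_compact (isCompact_Icc.prod isCompact_Icc)),
    integral_Icc_eq_integral_Ioc, ← intervalIntegral.integral_of_le hpr]
  congr 1
  ext t
  rw [integral_Icc_eq_integral_Ioc, ← intervalIntegral.integral_of_le hqs]
  rfl

lemma integral_max_sub (a b : ℝ) (hb : 0 < b) :
    ∫ t in a..(a + 2 * b), max (t - a - b) 0 = b ^ 2 / 2 := by
  have hcont : Continuous fun t : ℝ => max (t - a - b) 0 := by fun_prop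
  rw [← intervalIntegral.integral_add_adjacent_intervals (b := a + b)
    (hcont.intervalIntegrable _ _) (hcont.intervalIntegrable _ _),
    intervalIntegral.integral_congr (g := fun _ => 0), intervalIntegral.integral_zero, zero_add,
    intervalIntegral.integral_congr (a := a + b) (g := fun t => t - a - b),
    intervalIntegral.integral_eq_sub_of_hasDerivAt (f := fun t => (t - a - b) ^ 2 / 2)]
  · simp; ring
  · intro t _
    have := ((((hasDerivAt_id t).sub_const a).sub_const b).pow 2).div_const 2
    refine this.congr_deriv ?_
    norm_num
  · exact Continuous.intervalIntegrable (by fun_prop) _ _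
  · intro t ht
    rw [Set.uIcc_of_le (by linarith)] at ht
    exact max_eq_left (by linarith [ht.1])
  · intro t ht
    rw [Set.uIcc_of_le (by linarith)] at ht
    exact max_eq_right (by linarith [ht.2])

lemma integral_sub_sq (a b : ℝ) : ∫ u in a..(a + b), (u - a) ^ 2 = b ^ 3 / 3 := by
  rw [intervalIntegral.integral_comp_sub_right (fun u => u ^ 2)]
  simp [integral_pow]
  norm_num

lemma integral_triangle_slice {a₁ a₂ b t : ℝ} (h1 : a₁ ≤ t) (h2 : t ≤ a₁ + 2 * b) :
    ∫ u in a₂..(a₂ + b), ((t - a₁) * (u - a₂)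
        - max (t + 2 * u - (a₁ + 2 * a₂ + 2 * b)) 0 ^ 2 / 4)
          * (max (t + 2 * u - (a₁ + 2 * a₂ + 2 * b)) 0 ^ 2 / 4) =
      b * (t - a₁) ^ 4 / 24 - 11 * (t - a₁) ^ 5 / 960 := by
  have hcont : Continuous fun u : ℝ => ((t - a₁) * (u - a₂)
        - max (t + 2 * u - (a₁ + 2 * a₂ + 2 * b)) 0 ^ 2 / 4)
          * (max (t + 2 * u - (a₁ + 2 * a₂ + 2 * b)) 0 ^ 2 / 4) := by fun_prop
  set m := (a₁ + 2 * a₂ + 2 * b - t) / 2 with hm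
  rw [← intervalIntegral.integral_add_adjacent_intervals (b := m)
    (hcont.intervalIntegrable _ _) (hcont.intervalIntegrable _ _),
    intervalIntegral.integral_congr (g := fun _ => 0), intervalIntegral.integral_zero, zero_add,
    intervalIntegral.integral_congr (a := m) (g := fun u => (2 * (t - a₁)) * (u - m) ^ 3
      / 2 + (t - a₁) * (m - a₂) * (u - m) ^ 2 - (u - m) ^ 4),
    intervalIntegral.integral_eq_sub_of_hasDerivAt (f := fun u => (t - a₁) * (u - m) ^ 4 / 4
      + (t - a₁) * (m - a₂) * (u - m) ^ 3 / 3 - (u - m) ^ 5 / 5)]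
  · simp [hm]; ring
  · intro u _
    have h := (hasDerivAt_id u).sub_const m
    have := ((((h.pow 4).const_mul (t - a₁)).div_const 4).add
      (((h.pow 3).const_mul ((t - a₁) * (m - a₂))).div_const 3)).sub ((h.pow 5).div_const 5)
    refine this.congr_deriv ?_
    norm_num
    ring
  · exact Continuous.intervalIntegrable (by fun_prop) _ _
  · intro u ht
    rw [Set.uIcc_of_le (by linarith)] at ht
    have := ht.1
    beta_reduce
    rw [max_eq_left (by linarith), hm]
    ring
  · intro u ht
    rw [Set.uIcc_of_le (by linarith)] at ht
    have := ht.2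
    beta_reduce
    rw [max_eq_right (by linarith)]
    simp

lemma integral_triangle_product {a₁ a₂ b : ℝ} (hb : 0 < b) :
    ∫ t in a₁..(a₁ + 2 * b), ∫ u in a₂..(a₂ + b), ((t - a₁) * (u - a₂)
        - max (t + 2 * u - (a₁ + 2 * a₂ + 2 * b)) 0 ^ 2 / 4)
          * (max (t + 2 * u - (a₁ + 2 * a₂ + 2 * b)) 0 ^ 2 / 4) = 13 / 90 * b ^ 6 := by
  rw [intervalIntegral.integral_congr
    (g := fun t => b * (t - a₁) ^ 4 / 24 - 11 * (t - a₁) ^ 5 / 960),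
    intervalIntegral.integral_eq_sub_of_hasDerivAt
      (f := fun t => b * (t - a₁) ^ 5 / 120 - 11 * (t - a₁) ^ 6 / 5760)]
  · simp; ring
  · intro u _
    have h := (hasDerivAt_id u).sub_const a₁
    have := (((h.pow 5).const_mul b).div_const 120).sub (((h.pow 6).const_mul 11).div_const 5760)
    refine this.congr_deriv ?_
    norm_num
    ring
  · exact Continuous.intervalIntegrable (by fun_prop) _ _
  · intro t ht
    rw [Set.uIcc_of_le (by linarith)] at ht
    exact integral_triangle_slice ht.1 ht.2

lemma volume_ne_zero_and_ne_top_of_vol_pos {d : ℕ} {S : Set (Fin d → ℝ)} (h : 0 < vol S) :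
    volume S ≠ 0 ∧ volume S ≠ ⊤ := by
  obtain ⟨h0, ht⟩ := ENNReal.toReal_pos_iff.1 h
  exact ⟨h0.ne', ht.ne⟩

/-- Lemma 1: for the rectangle `I = [a₁, a₁+2b] × [a₂, a₂+b]`, the stratified sample
from the equivolume partition of `I` into the two triangles obtained by cutting along
the diagonal has strictly smaller mean squared L2-discrepancy than the stratified
sample from the partition into the two congruent squares. -/
theorem triangle_partition_beats_square_partition (a₁ a₂ b : ℝ) (hb : 0 < b) :
    meanL2sq (Set.Icc ![a₁, a₂] ![a₁ + 2 * b, a₂ + b])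
        ![convexHull ℝ {![a₁, a₂], ![a₁ + 2 * b, a₂], ![a₁, a₂ + b]},
          convexHull ℝ {![a₁ + 2 * b, a₂], ![a₁, a₂ + b], ![a₁ + 2 * b, a₂ + b]}] <
      meanL2sq (Set.Icc ![a₁, a₂] ![a₁ + 2 * b, a₂ + b])
        ![Set.Icc ![a₁, a₂] ![a₁ + b, a₂ + b],
          Set.Icc ![a₁ + b, a₂] ![a₁ + 2 * b, a₂ + b]] := by
  have hb2 : 0 < b ^ 2 := by positivity
  have hKv : vol (Set.Icc ![a₁, a₂] ![a₁ + 2 * b, a₂ + b]) = 2 * b ^ 2 := by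
    rw [vol_Icc_vec, max_eq_left (by linarith), max_eq_left (by linarith)]
    ring
  have hKt := (volume_ne_zero_and_ne_top_of_vol_pos (hKv ▸ by positivity :
    0 < vol (Set.Icc ![a₁, a₂] ![a₁ + 2 * b, a₂ + b]))).2
  have hKx : ∀ x ∈ Set.Icc ![a₁, a₂] ![a₁ + 2 * b, a₂ + b],
      vol (Set.Icc ![a₁, a₂] ![a₁ + 2 * b, a₂ + b] ∩ Set.Iic x) = (x 0 - a₁) * (x 1 - a₂) := by
    intro x hx
    obtain ⟨⟨h1, h2⟩, h3, h4⟩ := mem_Icc_vec.1 hx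
    rw [vol_Icc_vec_inter_Iic, min_eq_right h3, min_eq_right h4, max_eq_left (by linarith),
      max_eq_left (by linarith)]
  have hS0 : vol (Set.Icc ![a₁, a₂] ![a₁ + b, a₂ + b]) = b ^ 2 := by
    rw [vol_Icc_vec, max_eq_left (by linarith), max_eq_left (by linarith)]
    ring
  have hS1 : vol (Set.Icc ![a₁ + b, a₂] ![a₁ + 2 * b, a₂ + b]) = b ^ 2 := by
    rw [vol_Icc_vec, max_eq_left (by linarith), max_eq_left (by linarith)]
    ring
  have hT0 := vol_lower_triangle (a₁ := a₁) (a₂ := a₂) hb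
  have hT1 := vol_upper_triangle (a₁ := a₁) (a₂ := a₂) hb
  have hTm0 : MeasurableSet (convexHull ℝ {![a₁, a₂], ![a₁ + 2 * b, a₂], ![a₁, a₂ + b]}) := by
    rw [convexHull_lower_triangle a₁ a₂ b hb]; measurability
  have hTm1 : MeasurableSet
      (convexHull ℝ {![a₁ + 2 * b, a₂], ![a₁, a₂ + b], ![a₁ + 2 * b, a₂ + b]}) := by
    rw [convexHull_upper_triangle a₁ a₂ b hb]; measurability
  have hSx0 : ∀ x ∈ Set.Icc ![a₁, a₂] ![a₁ + 2 * b, a₂ + b],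
      vol (Set.Icc ![a₁, a₂] ![a₁ + b, a₂ + b] ∩ Set.Iic x) =
        (x 0 - a₁ - max (x 0 - a₁ - b) 0) * (x 1 - a₂) := by
    intro x hx
    obtain ⟨⟨h1, h2⟩, h3, h4⟩ := mem_Icc_vec.1 hx
    rw [vol_Icc_vec_inter_Iic, min_eq_right h4, max_eq_left (a := x 1 - a₂) (by linarith)]
    congr 1
    rcases le_total (x 0) (a₁ + b) with h | h
    · rw [min_eq_right h, max_eq_left (by linarith), max_eq_right (by linarith)]
      ring
    · rw [min_eq_left h, max_eq_left (by linarith), max_eq_left (by linarith)]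
      ring
  have hSx1 : ∀ x ∈ Set.Icc ![a₁, a₂] ![a₁ + 2 * b, a₂ + b],
      vol (Set.Icc ![a₁ + b, a₂] ![a₁ + 2 * b, a₂ + b] ∩ Set.Iic x) =
        max (x 0 - a₁ - b) 0 * (x 1 - a₂) := by
    intro x hx
    obtain ⟨⟨h1, h2⟩, h3, h4⟩ := mem_Icc_vec.1 hx
    rw [vol_Icc_vec_inter_Iic, min_eq_right h3, min_eq_right h4,
      max_eq_left (a := x 1 - a₂) (by linarith), sub_sub]
  rw [meanL2sq_fin_two measurableSet_Icc hKt, meanL2sq_fin_two measurableSet_Icc hKt, hKv]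
  · refine mul_lt_mul_of_pos_left ?_ (by positivity)
    refine add_lt_add_right (div_lt_div_of_pos_right ?_ two_pos) _
    have hT : ∫ x in Set.Icc ![a₁, a₂] ![a₁ + 2 * b, a₂ + b], ((x 0 - a₁) * (x 1 - a₂)
        - max (x 0 + 2 * x 1 - (a₁ + 2 * a₂ + 2 * b)) 0 ^ 2 / 4)
          * (max (x 0 + 2 * x 1 - (a₁ + 2 * a₂ + 2 * b)) 0 ^ 2 / 4) = 13 / 90 * b ^ 6 := by
      rw [← integral_triangle_product hb]
      exact setIntegral_Icc_vec (f := fun t u => ((t - a₁) * (u - a₂)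
        - max (t + 2 * u - (a₁ + 2 * a₂ + 2 * b)) 0 ^ 2 / 4)
          * (max (t + 2 * u - (a₁ + 2 * a₂ + 2 * b)) 0 ^ 2 / 4)) (by fun_prop) (by linarith)
        (by linarith)
    have hS : ∫ x in Set.Icc ![a₁, a₂] ![a₁ + 2 * b, a₂ + b],
        max (x 0 - a₁ - b) 0 * (x 1 - a₂) ^ 2 = b ^ 2 / 2 * (b ^ 3 / 3) := by
      rw [setIntegral_Icc_vec (f := fun t u => max (t - a₁ - b) 0 * (u - a₂) ^ 2) (by fun_prop)
        (by linarith) (by linarith)]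
      simp only [intervalIntegral.integral_const_mul, intervalIntegral.integral_mul_const,
        integral_sub_sq, integral_max_sub a₁ b hb]
    calc
      _ = ∫ x in Set.Icc ![a₁, a₂] ![a₁ + 2 * b, a₂ + b], (((x 0 - a₁) * (x 1 - a₂)
          - max (x 0 + 2 * x 1 - (a₁ + 2 * a₂ + 2 * b)) 0 ^ 2 / 4)
            * (max (x 0 + 2 * x 1 - (a₁ + 2 * a₂ + 2 * b)) 0 ^ 2 / 4)) / b ^ 4 := by
        refine setIntegral_congr_fun measurableSet_Icc fun x hx => ?_
        simp only [qfun, Matrix.cons_val_zero, Matrix.cons_val_one, hT0, hT1,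
          vol_lower_triangle_inter_Iic hb hx, vol_upper_triangle_inter_Iic hb hx]
        field_simp
      _ = 13 / 90 * b ^ 2 := by
        rw [integral_div, hT]
        field_simp
      _ < 1 / 6 * b ^ 2 := by linarith
      _ = ∫ x in Set.Icc ![a₁, a₂] ![a₁ + 2 * b, a₂ + b],
          (max (x 0 - a₁ - b) 0 * (x 1 - a₂) ^ 2) / b ^ 3 := by
        rw [integral_div, hS]
        field_simp
        norm_num
      _ = _ := by
        refine setIntegral_congr_fun measurableSet_Icc fun x hx => ?_
        simp only [qfun, Matrix.cons_val_zero, Matrix.cons_val_one, hS0, hS1, hSx0 x hx,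
          hSx1 x hx]
        have hz : (x 0 - a₁ - b) * max (x 0 - a₁ - b) 0 = max (x 0 - a₁ - b) 0 ^ 2 := by
          rcases le_total (x 0 - a₁ - b) 0 with h | h <;> simp [h, sq]
        field_simp
        linear_combination -(x 1 - a₂) ^ 2 * hz
  · exact Fin.forall_fin_two.2 ⟨measurableSet_Icc, measurableSet_Icc⟩
  · exact Fin.forall_fin_two.2 ⟨(volume_ne_zero_and_ne_top_of_vol_pos (hS0 ▸ hb2)).1,
      (volume_ne_zero_and_ne_top_of_vol_pos (hS1 ▸ hb2)).1⟩
  · exact Fin.forall_fin_two.2 ⟨(volume_ne_zero_and_ne_top_of_vol_pos (hS0 ▸ hb2)).2,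
      (volume_ne_zero_and_ne_top_of_vol_pos (hS1 ▸ hb2)).2⟩
  · intro x hx
    simp only [qfun, Matrix.cons_val_zero, Matrix.cons_val_one, hS0, hS1, hSx0 x hx, hSx1 x hx,
      hKx x hx, hKv]
    field_simp
    ring
  · exact Fin.forall_fin_two.2 ⟨hTm0, hTm1⟩
  · exact Fin.forall_fin_two.2 ⟨(volume_ne_zero_and_ne_top_of_vol_pos (hT0 ▸ hb2)).1,
      (volume_ne_zero_and_ne_top_of_vol_pos (hT1 ▸ hb2)).1⟩
  · exact Fin.forall_fin_two.2 ⟨(volume_ne_zero_and_ne_top_of_vol_pos (hT0 ▸ hb2)).2,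
      (volume_ne_zero_and_ne_top_of_vol_pos (hT1 ▸ hb2)).2⟩
  · intro x hx
    simp only [qfun, Matrix.cons_val_zero, Matrix.cons_val_one, hT0, hT1,
      vol_lower_triangle_inter_Iic hb hx, vol_upper_triangle_inter_Iic hb hx, hKx x hx, hKv]
    field_simp
    ring

end StratifiedSampling
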